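/- arXiv:1610.00531 — 2 statements merged into one kernel-verified Lean document; each statement's English description precedes it below -/
import Mathlib

section
/- Let q ∈ ℂ be nonzero and not a root of unity, let z ∈ ℂ and s ∈ ℕ. Then z^s = Σ_{r=0}^{s} (−1)^r q^{r(r−1)/2} binom(s,r)_q (z;q^{−1})_r, where (z;q^{−1})_r = ∏_{j=0}^{r−1}(1 − z q^{−j}). -/
/-- The q-Pochhammer symbol `(z;q)_m = ∏_{j=0}^{m-1} (1 - z q^j)`. -/
noncomputable def qPoch (q z : ℂ) (m : ℕ) : ℂ := ∏ j ∈ Finset.range m, (1 - z * q ^ j)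

/-- The q-binomial coefficient `binom(m,k)_q`. -/
noncomputable def qBinom (q : ℂ) (m k : ℕ) : ℂ :=
  if k ≤ m then qPoch q q m / (qPoch q q k * qPoch q q (m - k)) else 0

/-- `q` is not a root of unity. -/
def notRootOfUnity (q : ℂ) : Prop := ∀ m : ℕ, 0 < m → q ^ m ≠ 1

theorem qPoch_succ (q z : ℂ) (m : ℕ) : qPoch q z (m + 1) = qPoch q z m * (1 - z * q ^ m) :=
  Finset.prod_range_succ _ _

theorem qPoch_self_ne_zero {q : ℂ} (hq : notRootOfUnity q) (m : ℕ) : qPoch q q m ≠ 0 := by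
  refine Finset.prod_ne_zero_iff.mpr fun j _ h => hq (j + 1) j.succ_pos ?_
  rw [pow_succ']
  exact (sub_eq_zero.mp h).symm

theorem qBinom_zero_right {q : ℂ} (hq : notRootOfUnity q) (m : ℕ) : qBinom q m 0 = 1 := by
  have h := qPoch_self_ne_zero hq m
  have h0 : qPoch q q 0 = 1 := Finset.prod_range_zero _
  simp [qBinom, h0, h]

theorem qBinom_self {q : ℂ} (hq : notRootOfUnity q) (m : ℕ) : qBinom q m m = 1 := by
  have h := qPoch_self_ne_zero hq m
  have h0 : qPoch q q 0 = 1 := Finset.prod_range_zero _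
  simp [qBinom, h0, h]

theorem qBinom_eq_zero_of_lt (q : ℂ) {m k : ℕ} (h : m < k) : qBinom q m k = 0 :=
  if_neg (not_le.mpr h)

/-- The q-Pascal rule. -/
theorem qBinom_succ_succ {q : ℂ} (hq : notRootOfUnity q) (m k : ℕ) :
    qBinom q (m + 1) (k + 1) = q ^ (k + 1) * qBinom q m (k + 1) + qBinom q m k := by
  rcases lt_trichotomy m k with h | rfl | h
  · simp [qBinom_eq_zero_of_lt q h, qBinom_eq_zero_of_lt q (Nat.succ_lt_succ h),
      qBinom_eq_zero_of_lt q (h.trans k.lt_succ_self)]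
  · simp [qBinom_self hq, qBinom_eq_zero_of_lt q m.lt_succ_self]
  · obtain ⟨l, rfl⟩ := Nat.exists_eq_add_of_lt h
    have hk := qPoch_self_ne_zero hq k
    have hl := qPoch_self_ne_zero hq l
    have hk' := qPoch_self_ne_zero hq (k + 1)
    have hl' := qPoch_self_ne_zero hq (l + 1)
    rw [qPoch_succ] at hk' hl'
    have hk1 := right_ne_zero_of_mul hk'
    have hl1 := right_ne_zero_of_mul hl'
    rw [qBinom, qBinom, qBinom, if_pos (by omega), if_pos (by omega), if_pos (by omega),
      show k + l + 1 + 1 - (k + 1) = l + 1 by omega, show k + l + 1 - (k + 1) = l by omega,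
      show k + l + 1 - k = l + 1 by omega, qPoch_succ q q (k + l + 1), qPoch_succ q q k,
      qPoch_succ q q l]
    field_simp
    ring

theorem mul_qPoch_inv {q : ℂ} (hq0 : q ≠ 0) (z : ℂ) (r : ℕ) :
    z * qPoch q⁻¹ z r = q ^ r * (qPoch q⁻¹ z r - qPoch q⁻¹ z (r + 1)) := by
  rw [qPoch_succ, inv_pow]
  field_simp
  ring

/-- `z^s = Σ_{r=0}^{s} (−1)^r q^{r(r−1)/2} binom(s,r)_q (z;q^{−1})_r`. -/
theorem pow_eq_qBinom_sum (q : ℂ) (hq0 : q ≠ 0) (hq : notRootOfUnity q) (z : ℂ) (s : ℕ) :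
    z ^ s = ∑ r ∈ Finset.range (s + 1),
      (-1) ^ r * q ^ (r * (r - 1) / 2) * qBinom q s r * qPoch q⁻¹ z r := by
  induction s with
  | zero => simp [qBinom_self hq, qPoch]
  | succ s ih =>
    set f : ℕ → ℂ := fun r =>
      (-1) ^ r * q ^ (r * (r - 1) / 2) * qBinom q s r * q ^ r * qPoch q⁻¹ z r with hf
    have hlast : f (s + 1) = 0 := by simp [hf, qBinom_eq_zero_of_lt q s.lt_succ_self]
    have hshift : ∑ r ∈ Finset.range (s + 1), f r =
        ∑ r ∈ Finset.range (s + 1), f (r + 1) + f 0 := by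
      rw [← Finset.sum_range_succ', Finset.sum_range_succ _ (s + 1), hlast, add_zero]
    have hmul : z ^ (s + 1) = ∑ r ∈ Finset.range (s + 1), f r -
        ∑ r ∈ Finset.range (s + 1), (-1) ^ r * q ^ (r * (r - 1) / 2) * qBinom q s r * q ^ r *
          qPoch q⁻¹ z (r + 1) := by
      rw [pow_succ, ih, Finset.sum_mul, ← Finset.sum_sub_distrib]
      refine Finset.sum_congr rfl fun r _ => ?_
      linear_combination
        ((-1) ^ r * q ^ (r * (r - 1) / 2) * qBinom q s r) * mul_qPoch_inv hq0 z r
    have hzero : f 0 = (-1) ^ 0 * q ^ (0 * (0 - 1) / 2) * qBinom q (s + 1) 0 * qPoch q⁻¹ z 0 := by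
      simp [hf, qBinom_zero_right hq]
    rw [Finset.sum_range_succ', ← hzero, hmul, hshift, add_sub_right_comm,
      ← Finset.sum_sub_distrib]
    congr 1
    refine Finset.sum_congr rfl fun r _ => ?_
    simp only [hf]
    rw [qBinom_succ_succ hq, Nat.triangle_succ, pow_add q (r * (r - 1) / 2)]
    ring
end

section
/- Let n ≥ 2, let q, λ, μ ∈ ℂ with q nonzero and not a root of unity, λ ≠ 0, and let γ, α ∈ ℤ_{≥0}^n with γ ≤ α, (μ;q)_{|α|} ≠ 0 and q^{γ_1}λ ≠ 0. Write ᾱ = (α_2,…,α_n), γ̄ = (γ_2,…,γ_n). Then Φ_q^{(n)}(γ|α;λ,μ) = Φ_q^{(1)}(γ_1|α_1;λ,μ) · Φ_q^{(n−1)}(γ̄|ᾱ; q^{γ_1}λ, q^{α_1}μ), provided (q^{α_1}μ;q)_{|ᾱ|} ≠ 0 and (μ;q)_{α_1} ≠ 0. -/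
/-- `φ(β,γ) = Σ_{1 ≤ i < j ≤ k} β_i γ_j` for integer vectors. -/
def phi {k : ℕ} (β γ : Fin k → ℤ) : ℤ :=
  ∑ i, ∑ j, if i < j then β i * γ j else 0

open Classical in
/-- The weight `Φ_q^{(n)}(γ|β;λ,μ)` of the stochastic R matrix of `U_q(A^{(1)}_n)`. -/
noncomputable def Phi (n : ℕ) (q lam mu : ℂ) (γ β : Fin n → ℕ) : ℂ :=
  if γ ≤ β then
    q ^ phi (fun i => (β i : ℤ) - (γ i : ℤ)) (fun i => (γ i : ℤ))
      * (mu / lam) ^ (∑ i, γ i)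
      * qPoch q lam (∑ i, γ i) * qPoch q (mu / lam) ((∑ i, β i) - ∑ i, γ i)
      * (∏ i, qBinom q (β i) (γ i)) / qPoch q mu (∑ i, β i)
  else 0

theorem qPoch_add (q z : ℂ) (m k : ℕ) :
    qPoch q z (m + k) = qPoch q z m * qPoch q (q ^ m * z) k := by
  simp only [qPoch, Finset.prod_range_add]
  congr 1
  exact Finset.prod_congr rfl fun j _ => by ring

theorem phi_succ {k : ℕ} (β γ : Fin (k + 1) → ℤ) :
    phi β γ = β 0 * ∑ i, Fin.tail γ i + phi (Fin.tail β) (Fin.tail γ) := by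
  simp [phi, Fin.sum_univ_succ, Fin.tail, Finset.mul_sum]

theorem phi_one (β γ : Fin 1 → ℤ) : phi β γ = 0 := by
  simp [phi]

/-- First-coordinate factorization of `Φ`:
`Φ_q^{(n)}(γ|α;λ,μ) = Φ_q^{(1)}(γ_1|α_1;λ,μ) Φ_q^{(n−1)}(γ̄|ᾱ;q^{γ_1}λ,q^{α_1}μ)`
(stated with `n = N+1`, `N ≥ 1`, so that `n ≥ 2`). -/
theorem Phi_factor_head (N : ℕ) (hN : 1 ≤ N) (q lam mu : ℂ) (hq0 : q ≠ 0)
    (hq : notRootOfUnity q) (hlam : lam ≠ 0)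
    (γ α : Fin (N + 1) → ℕ) (hge : γ ≤ α)
    (hmu : qPoch q mu (∑ i, α i) ≠ 0)
    (hlam2 : q ^ (γ 0) * lam ≠ 0)
    (h1 : qPoch q (q ^ (α 0) * mu) (∑ i, Fin.tail α i) ≠ 0)
    (h2 : qPoch q mu (α 0) ≠ 0) :
    Phi (N + 1) q lam mu γ α =
      Phi 1 q lam mu (fun _ => γ 0) (fun _ => α 0) *
        Phi N q (q ^ (γ 0) * lam) (q ^ (α 0) * mu) (Fin.tail γ) (Fin.tail α) := by
  have head_le : γ 0 ≤ α 0 := hge 0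
  have tail_le : Fin.tail γ ≤ Fin.tail α := fun i => hge i.succ
  have sum_le : ∑ i, Fin.tail γ i ≤ ∑ i, Fin.tail α i := Finset.sum_le_sum fun i _ => tail_le i
  have sum_γ : ∑ i, γ i = γ 0 + ∑ i, Fin.tail γ i := Fin.sum_univ_succ γ
  have sum_α : ∑ i, α i = α 0 + ∑ i, Fin.tail α i := Fin.sum_univ_succ α
  have sum_sub : α 0 + ∑ i, Fin.tail α i - (γ 0 + ∑ i, Fin.tail γ i) =
      (α 0 - γ 0) + (∑ i, Fin.tail α i - ∑ i, Fin.tail γ i) := by omega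
  have ratio : q ^ α 0 * mu / (q ^ γ 0 * lam) = q ^ (α 0 - γ 0) * (mu / lam) := by
    rw [pow_sub₀ q hq0 head_le]
    field_simp
  have head_le' : (fun _ : Fin 1 => γ 0) ≤ fun _ => α 0 := fun _ => head_le
  have phi_eq : phi (fun i => (α i : ℤ) - (γ i : ℤ)) (fun i => (γ i : ℤ)) =
      ((α 0 - γ 0) * ∑ i, Fin.tail γ i : ℕ) +
        phi (fun i => (Fin.tail α i : ℤ) - (Fin.tail γ i : ℤ)) (fun i => (Fin.tail γ i : ℤ)) := by
    rw [phi_succ]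
    push_cast [head_le]
    rfl
  have prod_eq : ∏ i, qBinom q (α i) (γ i) =
      qBinom q (α 0) (γ 0) * ∏ i, qBinom q (Fin.tail α i) (Fin.tail γ i) :=
    Fin.prod_univ_succ _
  simp only [Phi, if_pos hge, if_pos tail_le, if_pos head_le', phi_one, phi_eq, prod_eq, sum_γ,
    sum_α, sum_sub, ratio, qPoch_add, Finset.univ_unique, Finset.sum_singleton,
    Finset.prod_singleton, zpow_zero, zpow_add₀ hq0, zpow_natCast, pow_mul, pow_add, mul_pow]
  rw [div_mul_div_comm]
  ring
end
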